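/- arXiv:1909.08877 — 7 statements merged into one kernel-verified Lean document; each statement's English description precedes it below -/
import Mathlib

section
/- For every model M of Vaught set theory VS, the structure M⁺ (with the same domain as M and membership reinterpreted as ∈⁺, where u ∈⁺ v iff u ∈ v and PC₁(v)) is a model of VS⁺. (This is the semantic content of the theorem that VS directly interprets VS⁺ via a one-dimensional, unrelativized, identity-preserving interpretation.) -/
/-!
Vaught set theory `VS`, semantically: a type `M` with a membership relation `mem`
satisfying (VS1) an empty set exists and (VS2ₙ, n ≥ 1) every nonempty finite
collection of elements is the extension of some element.
-/

namespace VS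

variable {M : Type*}

/-- `p` is a (Kuratowski) pair-representative of `(u, v)`. -/
def IsPairRep (mem : M → M → Prop) (p u v : M) : Prop :=
  ∃ a b : M, (∀ z, mem z p ↔ (z = a ∨ z = b)) ∧ (∀ z, mem z a ↔ z = u) ∧
    (∀ z, mem z b ↔ (z = u ∨ z = v))

/-- `f` is a function: all of its elements are pair-representatives, and any two
elements of `f` with the same first component are equal. -/
def IsFunc (mem : M → M → Prop) (f : M) : Prop :=
  (∀ w, mem w f → ∃ u v, IsPairRep mem w u v) ∧
  (∀ w w' u v u' v', mem w f → mem w' f → IsPairRep mem w u v → IsPairRep mem w' u' v' →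
    u = u' → w = w')

/-- `f : x ∼ y`: `f` is a bijection between `x` and `y`. -/
def IsBij (mem : M → M → Prop) (f x y : M) : Prop :=
  IsFunc mem f ∧
  (∀ w u v, mem w f → IsPairRep mem w u v → mem u x ∧ mem v y) ∧
  (∀ u, mem u x → ∃ w v, mem w f ∧ IsPairRep mem w u v) ∧
  (∀ v, mem v y → ∃ w u, mem w f ∧ IsPairRep mem w u v) ∧
  (∀ w w' u v u' v', mem w f → mem w' f → IsPairRep mem w u v → IsPairRep mem w' u' v' →
    v = v' → w = w')

/-- `x ∼ y`: there is a bijection between `x` and `y`. -/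
def Sim (mem : M → M → Prop) (x y : M) : Prop := ∃ f, IsBij mem f x y

/-- The class `PC₀`. -/
def PC0 (mem : M → M → Prop) (x : M) : Prop :=
  Sim mem x x ∧ (∀ y z, Sim mem x y → Sim mem x z → Sim mem y z) ∧
  (∀ y z, Sim mem x y → Sim mem y z → Sim mem x z)

/-- The class `PC₁`. -/
def PC1 (mem : M → M → Prop) (x : M) : Prop :=
  PC0 mem x ∧ ∀ u v f, Sim mem x u → Sim mem u v → IsBij mem f u v → Sim mem u f

/-- The reinterpreted membership relation `∈⁺`: `u ∈⁺ v` iff `u ∈ v` and `PC₁(v)`. -/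
def memPlus (mem : M → M → Prop) (u v : M) : Prop := mem u v ∧ PC1 mem v

/-- The axioms of Vaught set theory `VS`: (VS1) there is an empty set, and
(VS2ₙ for n ≥ 1) any nonempty finite list of elements is the extension of some element. -/
def VSAx (mem : M → M → Prop) : Prop :=
  (∃ x, ∀ y, ¬ mem y x) ∧
  (∀ l : List M, l ≠ [] → ∃ x, ∀ y, mem y x ↔ y ∈ l)

end VS

namespace VS

variable {M : Type*} {mem : M → M → Prop}

theorem IsPairRep.unique {p u v u' v' : M} (h : IsPairRep mem p u v)
    (h' : IsPairRep mem p u' v') : u = u' ∧ v = v' := by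
  obtain ⟨a, b, hp, ha, hb⟩ := h
  obtain ⟨a', b', hp', ha', hb'⟩ := h'
  have := hp a
  have := hp b
  have := hp a'
  have := hp b'
  have := ha u
  have := hb u
  have := hb v
  have := hb' v'
  grind

theorem VSAx.exists_of_finite (h : VSAx mem) {s : Set M} (hs : s.Finite) :
    ∃ x, ∀ y, mem y x ↔ y ∈ s := by
  rcases s.eq_empty_or_nonempty with rfl | ⟨z, hz⟩
  · simpa using h.1
  · obtain ⟨x, hx⟩ := h.2 hs.toFinset.toList
      (by simpa [Set.Finite.toFinset_eq_empty] using Set.Nonempty.ne_empty ⟨z, hz⟩)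
    exact ⟨x, by simpa using hx⟩

theorem VSAx.exists_pairRep (h : VSAx mem) (u v : M) : ∃ p, IsPairRep mem p u v := by
  obtain ⟨a, ha⟩ := h.2 [u] (by simp)
  obtain ⟨b, hb⟩ := h.2 [u, v] (by simp)
  obtain ⟨p, hp⟩ := h.2 [a, b] (by simp)
  exact ⟨p, a, b, by simpa using hp, by simpa using ha, by simpa using hb⟩

theorem sim_of_equiv (h : VSAx mem) {x y : M} (hx : {z | mem z x}.Finite)
    (e : {z | mem z x} ≃ {z | mem z y}) : Sim mem x y := by
  choose p hp using h.exists_pairRep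
  have := hx.to_subtype
  obtain ⟨f, hf⟩ := h.exists_of_finite
    (Set.finite_range fun u : {z | mem z x} => p u (e u))
  have key : ∀ {w u v}, mem w f → IsPairRep mem w u v →
      ∃ t : {z | mem z x}, w = p t (e t) ∧ u = t ∧ v = e t := by
    intro w u v hw hr
    obtain ⟨t, rfl⟩ := (hf w).1 hw
    exact ⟨t, rfl, hr.unique (hp _ _)⟩
  refine ⟨f, ⟨?_, ?_⟩, ?_, ?_, ?_, ?_⟩
  · intro w hw
    obtain ⟨t, rfl⟩ := (hf w).1 hw
    exact ⟨_, _, hp _ _⟩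
  · intro w w' u v u' v' hw hw' hr hr' huv
    obtain ⟨t, rfl, rfl, -⟩ := key hw hr
    obtain ⟨t', rfl, rfl, -⟩ := key hw' hr'
    rw [Subtype.ext huv]
  · intro w u v hw hr
    obtain ⟨t, -, rfl, rfl⟩ := key hw hr
    exact ⟨t.2, (e t).2⟩
  · intro u hu
    exact ⟨_, _, (hf _).2 ⟨⟨u, hu⟩, rfl⟩, hp _ _⟩
  · intro v hv
    obtain ⟨t, ht⟩ := e.surjective ⟨v, hv⟩
    exact ⟨_, t, (hf _).2 ⟨t, rfl⟩, by simpa [ht] using hp t v⟩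
  · intro w w' u v u' v' hw hw' hr hr' huv
    obtain ⟨t, rfl, -, rfl⟩ := key hw hr
    obtain ⟨t', rfl, -, rfl⟩ := key hw' hr'
    rw [e.injective (Subtype.ext huv)]

theorem IsBij.nonempty_equiv_domain {f x y : M} (h : IsBij mem f x y) :
    Nonempty ({z | mem z f} ≃ {z | mem z x}) := by
  obtain ⟨⟨hrep, hfun⟩, hmem, hdom, -, -⟩ := h
  choose fst snd hr using hrep
  refine ⟨Equiv.ofBijective
    (fun w : {z | mem z f} => ⟨fst w w.2, (hmem _ _ _ w.2 (hr w w.2)).1⟩) ⟨?_, ?_⟩⟩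
  · intro w w' hww
    exact Subtype.ext (hfun _ _ _ _ _ _ w.2 w'.2 (hr _ _) (hr _ _) (congrArg Subtype.val hww))
  · rintro ⟨u, hu⟩
    obtain ⟨w, v, hw, hwr⟩ := hdom u hu
    exact ⟨⟨w, hw⟩, Subtype.ext ((hr w hw).unique hwr).1⟩

theorem IsBij.nonempty_equiv_codomain {f x y : M} (h : IsBij mem f x y) :
    Nonempty ({z | mem z f} ≃ {z | mem z y}) := by
  obtain ⟨⟨hrep, -⟩, hmem, -, hcod, hinj⟩ := h
  choose fst snd hr using hrep
  refine ⟨Equiv.ofBijective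
    (fun w : {z | mem z f} => ⟨snd w w.2, (hmem _ _ _ w.2 (hr w w.2)).2⟩) ⟨?_, ?_⟩⟩
  · intro w w' hww
    exact Subtype.ext (hinj _ _ _ _ _ _ w.2 w'.2 (hr _ _) (hr _ _) (congrArg Subtype.val hww))
  · rintro ⟨v, hv⟩
    obtain ⟨w, u, hw, hwr⟩ := hcod v hv
    exact ⟨⟨w, hw⟩, Subtype.ext ((hr w hw).unique hwr).2⟩

theorem Sim.nonempty_equiv {x y : M} (h : Sim mem x y) :
    Nonempty ({z | mem z x} ≃ {z | mem z y}) := by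
  obtain ⟨f, hf⟩ := h
  obtain ⟨e⟩ := hf.nonempty_equiv_domain
  obtain ⟨e'⟩ := hf.nonempty_equiv_codomain
  exact ⟨e.symm.trans e'⟩

theorem Sim.empty_iff {x y : M} (h : Sim mem x y) : (∀ z, ¬ mem z x) ↔ ∀ z, ¬ mem z y := by
  obtain ⟨e⟩ := h.nonempty_equiv
  exact ⟨fun hx z hz => hx _ (e.symm ⟨z, hz⟩).2, fun hy z hz => hy _ (e ⟨z, hz⟩).2⟩

theorem Sim.finite {x y : M} (h : Sim mem x y) (hx : {z | mem z x}.Finite) :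
    {z | mem z y}.Finite := by
  obtain ⟨e⟩ := h.nonempty_equiv
  have := hx.to_subtype
  exact Finite.of_equiv _ e

theorem pc1_of_finite (h : VSAx mem) {x : M} (hx : {z | mem z x}.Finite) : PC1 mem x := by
  refine ⟨⟨sim_of_equiv h hx (Equiv.refl _), ?_, ?_⟩, ?_⟩
  · intro y z hy hz
    obtain ⟨e⟩ := hy.nonempty_equiv
    obtain ⟨e'⟩ := hz.nonempty_equiv
    exact sim_of_equiv h (hy.finite hx) (e.symm.trans e')
  · intro y z hy hz
    obtain ⟨e⟩ := hy.nonempty_equiv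
    obtain ⟨e'⟩ := hz.nonempty_equiv
    exact sim_of_equiv h hx (e.trans e')
  · intro u v f hu _ hf
    obtain ⟨e⟩ := hf.nonempty_equiv_domain
    exact sim_of_equiv h (hu.finite hx) e.symm

theorem PC1.of_sim {x y : M} (hx : PC1 mem x) (hxy : Sim mem x y) : PC1 mem y := by
  obtain ⟨⟨-, heucl, htrans⟩, hgraph⟩ := hx
  exact ⟨⟨heucl _ _ hxy hxy,
    fun z w hz hw => heucl _ _ (htrans _ _ hxy hz) (htrans _ _ hxy hw),
    fun z w hz hw => heucl _ _ hxy (htrans _ _ (htrans _ _ hxy hz) hw)⟩,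
    fun u v f hu => hgraph u v f (htrans _ _ hxy hu)⟩

theorem memPlus_iff {x : M} (hx : PC1 mem x) (z : M) : memPlus mem z x ↔ mem z x :=
  and_iff_left hx

theorem isPairRep_memPlus_iff (h : VSAx mem) {p u v : M} :
    IsPairRep (memPlus mem) p u v ↔ IsPairRep mem p u v := by
  constructor
  · rintro ⟨a, b, hp, ha, hb⟩
    have hp' := ((hp a).2 (Or.inl rfl)).2
    have ha' := ((ha u).2 rfl).2
    have hb' := ((hb u).2 (Or.inl rfl)).2
    simp only [memPlus_iff hp', memPlus_iff ha', memPlus_iff hb'] at hp ha hb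
    exact ⟨a, b, hp, ha, hb⟩
  · rintro ⟨a, b, hp, ha, hb⟩
    have pc1_pair : ∀ {x c d}, (∀ z, mem z x ↔ z = c ∨ z = d) → PC1 mem x := fun {x c d} hx =>
      pc1_of_finite h ((Set.toFinite {c, d}).subset fun z hz => (hx z).1 hz)
    have hp' := pc1_pair hp
    have ha' : PC1 mem a := pc1_pair (c := u) (d := u) (by simpa using ha)
    have hb' := pc1_pair hb
    refine ⟨a, b, ?_⟩
    simpa only [memPlus_iff hp', memPlus_iff ha', memPlus_iff hb'] using ⟨hp, ha, hb⟩

theorem isBij_memPlus_iff (h : VSAx mem) {f x y : M} (hf : PC1 mem f) (hx : PC1 mem x)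
    (hy : PC1 mem y) : IsBij (memPlus mem) f x y ↔ IsBij mem f x y := by
  simp only [IsBij, IsFunc, memPlus_iff hf, memPlus_iff hx, memPlus_iff hy,
    isPairRep_memPlus_iff h]

theorem isBij_of_empty {f x y : M} (hf : ∀ z, ¬ mem z f) (hx : ∀ z, ¬ mem z x)
    (hy : ∀ z, ¬ mem z y) : IsBij mem f x y := by
  simp [IsBij, IsFunc, hf, hx, hy]

theorem IsBij.empty_or_pc1 (h : VSAx mem) {f x y : M} (hf : IsBij (memPlus mem) f x y) :
    ((∀ z, ¬ memPlus mem z f) ∧ (∀ z, ¬ memPlus mem z x) ∧ ∀ z, ¬ memPlus mem z y) ∨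
      (PC1 mem f ∧ PC1 mem x ∧ PC1 mem y ∧ IsBij mem f x y) := by
  by_cases hempty : ∀ z, ¬ memPlus mem z f
  · refine Or.inl ⟨hempty, fun z hz => ?_, fun z hz => ?_⟩
    · obtain ⟨w, _, hw, -⟩ := hf.2.2.1 z hz
      exact hempty w hw
    · obtain ⟨w, _, hw, -⟩ := hf.2.2.2.1 z hz
      exact hempty w hw
  · push Not at hempty
    obtain ⟨w, hw⟩ := hempty
    obtain ⟨u, v, hr⟩ := hf.1.1 w hw
    obtain ⟨hu, hv⟩ := hf.2.1 w u v hw hr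
    exact Or.inr ⟨hw.2, hu.2, hv.2, (isBij_memPlus_iff h hw.2 hu.2 hv.2).1 hf⟩

theorem Sim.memPlus_of_pc1 (h : VSAx mem) {x y : M} (hx : PC1 mem x) (hxy : Sim mem x y) :
    Sim (memPlus mem) x y := by
  obtain ⟨f, hf⟩ := hxy
  have hy := hx.of_sim ⟨f, hf⟩
  have hf' := hx.of_sim (hx.2 x y f hx.1.1 ⟨f, hf⟩ hf)
  exact ⟨f, (isBij_memPlus_iff h hf' hx hy).2 hf⟩

theorem VSAx.sim_memPlus_of_empty (h : VSAx mem) {x y : M} (hx : ∀ z, ¬ memPlus mem z x)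
    (hy : ∀ z, ¬ memPlus mem z y) : Sim (memPlus mem) x y := by
  obtain ⟨o, ho⟩ := h.1
  exact ⟨o, isBij_of_empty (fun z hz => ho z hz.1) hx hy⟩

theorem Sim.empty_or_pc1 (h : VSAx mem) {x y : M} (hxy : Sim (memPlus mem) x y) :
    ((∀ z, ¬ memPlus mem z x) ∧ ∀ z, ¬ memPlus mem z y) ∨
      (PC1 mem x ∧ PC1 mem y ∧ Sim mem x y) := by
  obtain ⟨f, hf⟩ := hxy
  rcases hf.empty_or_pc1 h with ⟨-, hx, hy⟩ | ⟨-, hx, hy, hf'⟩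
  · exact Or.inl ⟨hx, hy⟩
  · exact Or.inr ⟨hx, hy, f, hf'⟩

theorem VSAx.memPlus (h : VSAx mem) : VSAx (memPlus mem) := by
  refine ⟨h.1.imp fun o ho z hz => ho z hz.1, fun l hl => ?_⟩
  obtain ⟨x, hx⟩ := h.2 l hl
  have hx' : PC1 mem x :=
    pc1_of_finite h (l.finite_toSet.subset fun z hz => (hx z).1 hz)
  exact ⟨x, by simpa only [memPlus_iff hx'] using hx⟩

theorem VSAx.sim_memPlus_equivalence (h : VSAx mem) : Equivalence (Sim (VS.memPlus mem)) := by
  refine ⟨fun x => ?_, fun {x y} hxy => ?_, fun {x y z} hxy hyz => ?_⟩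
  · by_cases hx : PC1 mem x
    · exact hx.1.1.memPlus_of_pc1 h hx
    · exact h.sim_memPlus_of_empty (fun z hz => hx hz.2) (fun z hz => hx hz.2)
  · rcases hxy.empty_or_pc1 h with ⟨hx, hy⟩ | ⟨hx, hy, hxy'⟩
    · exact h.sim_memPlus_of_empty hy hx
    · exact (hx.1.2.1 _ _ hxy' hx.1.1).memPlus_of_pc1 h hy
  · rcases hxy.empty_or_pc1 h with ⟨hx, hy⟩ | ⟨hx, hy, hxy'⟩ <;>
      rcases hyz.empty_or_pc1 h with ⟨hy', hz⟩ | ⟨hy', hz, hyz'⟩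
    · exact h.sim_memPlus_of_empty hx hz
    · exact h.sim_memPlus_of_empty hx (hyz.empty_iff.1 hy)
    · exact h.sim_memPlus_of_empty (hxy.empty_iff.2 hy') hz
    · exact (hx.1.2.2 _ _ hxy' hyz').memPlus_of_pc1 h hx

end VS

open VS in
/-- If `M` is a model of `VS`, then `M⁺` (same domain, membership `∈⁺`) is a model of `VS⁺`:
it satisfies the `VS` axioms, `∼` (computed in `M⁺`) is an equivalence relation, and
whenever `f : x ∼ y` in `M⁺` we have `x ∼ f` in `M⁺`. -/
theorem VS_directly_interprets_VSplus {M : Type*} (mem : M → M → Prop) (h : VSAx mem) :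
    VSAx (memPlus mem) ∧
    Equivalence (Sim (memPlus mem)) ∧
    (∀ f x y, IsBij (memPlus mem) f x y → Sim (memPlus mem) x f) := by
  refine ⟨h.memPlus, h.sim_memPlus_equivalence, fun f x y hf => ?_⟩
  rcases hf.empty_or_pc1 h with ⟨hf', hx, -⟩ | ⟨-, hx, -, hf'⟩
  · exact h.sim_memPlus_of_empty hx hf'
  · exact (hx.2 x y f hx.1.1 ⟨f, hf'⟩ hf').memPlus_of_pc1 h hx
end

section
/- Let M be a model of Vaught set theory VS. Then Kuratowski pairing works in M: (existence) for all u, v ∈ M there exists p ∈ M that is a pair-representative of (u,v); (uniqueness of components) if p is a pair-representative of both (u,v) and (u',v'), then u = u' and v = v'. -/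
open VS in
/-- In a model of `VS`, Kuratowski pairing works: pair-representatives exist for every
`(u, v)`, and the components of a pair-representative are unique. -/
theorem kuratowski_pairing {M : Type*} (mem : M → M → Prop) (h : VSAx mem) :
    (∀ u v : M, ∃ p : M, IsPairRep mem p u v) ∧
    (∀ p u v u' v' : M, IsPairRep mem p u v → IsPairRep mem p u' v' → u = u' ∧ v = v') := by
  refine ⟨fun u v => ?_, ?_⟩
  · obtain ⟨a, ha⟩ := h.2 [u] (by simp)
    obtain ⟨b, hb⟩ := h.2 [u, v] (by simp)
    obtain ⟨p, hp⟩ := h.2 [a, b] (by simp)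
    exact ⟨p, a, b, by simpa using hp, by simpa using ha, by simpa using hb⟩
  · rintro p u v u' v' ⟨a, b, hp, ha, hb⟩ ⟨a', b', hp', ha', hb'⟩
    have hu : u' = u := by
      rcases (hp' a).1 ((hp a).2 (Or.inl rfl)) with rfl | rfl
      · exact (ha u').1 ((ha' u').2 rfl)
      · exact (ha u').1 ((hb' u').2 (Or.inl rfl))
    subst hu
    have hv : v = u' ∨ v = v' := by
      rcases (hp' b).1 ((hp b).2 (Or.inr rfl)) with rfl | rfl
      · exact Or.inl ((ha' v).1 ((hb v).2 (Or.inr rfl)))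
      · exact (hb' v).1 ((hb v).2 (Or.inr rfl))
    have hv' : v' = u' ∨ v' = v := by
      rcases (hp b').1 ((hp' b').2 (Or.inr rfl)) with rfl | rfl
      · exact Or.inl ((ha v').1 ((hb' v').2 (Or.inr rfl)))
      · exact (hb v').1 ((hb' v').2 (Or.inr rfl))
    exact ⟨rfl, by grind⟩
end

section
/- For every injective map ν from the set of L₀-sentences to ℕ, there is no set X ⊆ ℕ definable in 𝔑 such that for every L₀-sentence A: 𝔑 ⊨ A if and only if ν(A) ∈ X. (Hence the theory of 𝔑 admits no truth definition over itself for any injective Gödel numbering: the identity interpretation cannot witness the Enayat property for W = Th(𝔑).) -/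
open FirstOrder FirstOrder.Language

/-- The language `L₀` with a constant `0`, a unary function `S`, and a binary relation `<`. -/
def L0 : FirstOrder.Language where
  Functions n := match n with
    | 0 => Unit
    | 1 => Unit
    | _ => Empty
  Relations n := match n with
    | 2 => Unit
    | _ => Empty

/-- The standard structure `𝔑 = (ℕ; 0, n ↦ n + 1, <)`. -/
instance natL0 : L0.Structure ℕ where
  funMap {n} f x :=
    match n, f with
    | 0, _ => 0
    | 1, _ => x 0 + 1
  RelMap {n} r x :=
    match n, r with
    | 2, _ => x 0 < x 1

namespace L0

/-- The ultrapower of `𝔑` along `u`. -/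
abbrev Ultrapower (u : Ultrafilter ℕ) : Type := (u : Filter ℕ).Product (fun _ => ℕ)

/-- A sequence is standard along `u` if it is `u`-almost everywhere constant. -/
def IsStandard (u : Ultrafilter ℕ) (f : ℕ → ℕ) : Prop := ∃ c, ∀ᶠ n in (u : Filter ℕ), f n = c

variable {u : Ultrafilter ℕ} {f g : ℕ → ℕ}

theorem IsStandard.congr (h : ∀ᶠ n in (u : Filter ℕ), f n = g n) (hf : IsStandard u f) :
    IsStandard u g := by
  obtain ⟨c, hc⟩ := hf
  refine ⟨c, ?_⟩
  filter_upwards [h, hc] with n h1 h2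
  omega

theorem isStandard_add_one_iff : IsStandard u (fun n => f n + 1) ↔ IsStandard u f := by
  refine ⟨fun ⟨c, hc⟩ => ⟨c - 1, ?_⟩, fun ⟨c, hc⟩ => ⟨c + 1, ?_⟩⟩ <;>
    filter_upwards [hc] with n h <;> omega

theorem eventually_lt_of_not_isStandard (hf : ¬ IsStandard u f) (c : ℕ) :
    ∀ᶠ n in (u : Filter ℕ), c < f n := by
  have hne (c : ℕ) : ∀ᶠ n in (u : Filter ℕ), f n ≠ c :=
    Ultrafilter.eventually_not.2 fun h => hf ⟨c, h⟩
  induction c with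
  | zero => filter_upwards [hne 0] with n h using Nat.pos_of_ne_zero h
  | succ c ih =>
    filter_upwards [ih, hne (c + 1)] with n h1 h2
    omega

open Classical in
/-- Fix the standard sequences and add one to the nonstandard ones. -/
noncomputable def shiftSeq (u : Ultrafilter ℕ) (f : ℕ → ℕ) : ℕ → ℕ :=
  if IsStandard u f then f else fun n => f n + 1

theorem shiftSeq_of_isStandard (hf : IsStandard u f) : shiftSeq u f = f := if_pos hf

theorem shiftSeq_of_not_isStandard (hf : ¬ IsStandard u f) :
    shiftSeq u f = fun n => f n + 1 := if_neg hf

theorem shiftSeq_eventuallyEq_iff :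
    (∀ᶠ n in (u : Filter ℕ), shiftSeq u f n = shiftSeq u g n) ↔
      ∀ᶠ n in (u : Filter ℕ), f n = g n := by
  have key (f g : ℕ → ℕ) (hf : IsStandard u f) (hg : ¬ IsStandard u g) :
      ¬ ∀ᶠ n in (u : Filter ℕ), f n = g n := fun h => hg (hf.congr h)
  by_cases hf : IsStandard u f <;> by_cases hg : IsStandard u g
  · rw [shiftSeq_of_isStandard hf, shiftSeq_of_isStandard hg]
  · rw [shiftSeq_of_isStandard hf, shiftSeq_of_not_isStandard hg]
    exact iff_of_false (key _ _ hf (isStandard_add_one_iff.not.2 hg)) (key _ _ hf hg)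
  · rw [shiftSeq_of_not_isStandard hf, shiftSeq_of_isStandard hg]
    simp only [eq_comm (b := g _)]
    exact iff_of_false (key _ _ hg (isStandard_add_one_iff.not.2 hf)) (key _ _ hg hf)
  · simp [shiftSeq_of_not_isStandard hf, shiftSeq_of_not_isStandard hg]

theorem shiftSeq_eventually_lt_iff :
    (∀ᶠ n in (u : Filter ℕ), shiftSeq u f n < shiftSeq u g n) ↔
      ∀ᶠ n in (u : Filter ℕ), f n < g n := by
  have key (f g : ℕ → ℕ) (hf : IsStandard u f) (hg : ¬ IsStandard u g) :
      ∀ᶠ n in (u : Filter ℕ), f n < g n := by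
    obtain ⟨c, hc⟩ := hf
    filter_upwards [hc, eventually_lt_of_not_isStandard hg c] with n h1 h2
    omega
  have key' (f g : ℕ → ℕ) (hf : IsStandard u f) (hg : ¬ IsStandard u g) :
      ¬ ∀ᶠ n in (u : Filter ℕ), g n < f n := by
    refine Ultrafilter.eventually_not.1 ?_
    filter_upwards [key f g hf hg] with n h
    omega
  by_cases hf : IsStandard u f <;> by_cases hg : IsStandard u g
  · rw [shiftSeq_of_isStandard hf, shiftSeq_of_isStandard hg]
  · rw [shiftSeq_of_isStandard hf, shiftSeq_of_not_isStandard hg]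
    exact iff_of_true (key _ _ hf (isStandard_add_one_iff.not.2 hg)) (key _ _ hf hg)
  · rw [shiftSeq_of_not_isStandard hf, shiftSeq_of_isStandard hg]
    exact iff_of_false (key' _ _ hg (isStandard_add_one_iff.not.2 hf)) (key' _ _ hg hf)
  · simp [shiftSeq_of_not_isStandard hf, shiftSeq_of_not_isStandard hg]

theorem exists_shiftSeq_eventuallyEq (u : Ultrafilter ℕ) (g : ℕ → ℕ) :
    ∃ f, ∀ᶠ n in (u : Filter ℕ), shiftSeq u f n = g n := by
  by_cases hg : IsStandard u g
  · exact ⟨g, by simp [shiftSeq_of_isStandard hg]⟩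
  · have hpos : ∀ᶠ n in (u : Filter ℕ), g n = (g n - 1) + 1 := by
      filter_upwards [eventually_lt_of_not_isStandard hg 0] with n h
      omega
    have hf : ¬ IsStandard u (fun n => g n - 1) := fun h =>
      hg ((isStandard_add_one_iff.2 h).congr (hpos.mono fun n h => h.symm))
    exact ⟨fun n => g n - 1, by
      rw [shiftSeq_of_not_isStandard hf]; exact hpos.mono fun n h => h.symm⟩

theorem shiftSeq_add_one (u : Ultrafilter ℕ) (f : ℕ → ℕ) :
    shiftSeq u (fun n => f n + 1) = fun n => shiftSeq u f n + 1 := by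
  by_cases hf : IsStandard u f
  · rw [shiftSeq_of_isStandard hf, shiftSeq_of_isStandard (isStandard_add_one_iff.2 hf)]
  · rw [shiftSeq_of_not_isStandard hf,
      shiftSeq_of_not_isStandard (isStandard_add_one_iff.not.2 hf)]

/-- The map on the ultrapower induced by `shiftSeq`. -/
noncomputable def shiftMap (u : Ultrafilter ℕ) : Ultrapower u → Ultrapower u :=
  Quotient.map (shiftSeq u) fun _ _ h => shiftSeq_eventuallyEq_iff.2 h

theorem shiftMap_bijective (u : Ultrafilter ℕ) : Function.Bijective (shiftMap u) := by
  constructor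
  · rintro ⟨f⟩ ⟨g⟩ h
    exact Quotient.sound (shiftSeq_eventuallyEq_iff.1 (Quotient.exact h))
  · rintro ⟨g⟩
    obtain ⟨f, hf⟩ := exists_shiftSeq_eventuallyEq u g
    exact ⟨Quotient.mk _ f, Quotient.sound hf⟩

/-- The automorphism of the ultrapower that fixes the standard elements and moves every
nonstandard element to its successor. -/
noncomputable def shiftEquiv (u : Ultrafilter ℕ) : Ultrapower u ≃[L0] Ultrapower u where
  toEquiv := Equiv.ofBijective (shiftMap u) (shiftMap_bijective u)
  map_fun' {n} F x := by
    obtain ⟨x, rfl⟩ : ∃ y : Fin n → ℕ → ℕ, x = fun i => (Quotient.mk _ (y i) : Ultrapower u) :=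
      ⟨fun i => (x i).out, funext fun i => (Quotient.out_eq (x i)).symm⟩
    change shiftMap u (Structure.funMap F fun i => (Quotient.mk _ (x i) : Ultrapower u)) =
      Structure.funMap F fun i => (Quotient.mk _ (shiftSeq u (x i)) : Ultrapower u)
    erw [Ultraproduct.funMap_cast, Ultraproduct.funMap_cast]
    match n, F with
    | 0, _ =>
      exact congrArg (Quotient.mk ((u : Filter ℕ).productSetoid fun _ => ℕ))
        (shiftSeq_of_isStandard ⟨0, Filter.Eventually.of_forall fun _ => rfl⟩)
    | 1, _ =>
      exact congrArg (Quotient.mk ((u : Filter ℕ).productSetoid fun _ => ℕ))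
        (shiftSeq_add_one u (x 0))
    | _ + 2, F => exact nomatch F
  map_rel' {n} R x := by
    obtain ⟨x, rfl⟩ : ∃ y : Fin n → ℕ → ℕ, x = fun i => (Quotient.mk _ (y i) : Ultrapower u) :=
      ⟨fun i => (x i).out, funext fun i => (Quotient.out_eq (x i)).symm⟩
    change Structure.RelMap R (fun i => (Quotient.mk _ (shiftSeq u (x i)) : Ultrapower u)) ↔
      Structure.RelMap R fun i => (Quotient.mk _ (x i) : Ultrapower u)
    refine (relMap_quotient_mk' (s := (u : Filter ℕ).productSetoid fun _ => ℕ) R _).trans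
      (Iff.trans ?_ (relMap_quotient_mk' (s := (u : Filter ℕ).productSetoid fun _ => ℕ) R _).symm)
    match n, R with
    | 2, _ => exact shiftSeq_eventually_lt_iff

theorem eventually_realize_shiftSeq_iff {β : Type*} (φ : L0.Formula β) (x : β → ℕ → ℕ) :
    (∀ᶠ n in (u : Filter ℕ), φ.Realize fun i => shiftSeq u (x i) n) ↔
      ∀ᶠ n in (u : Filter ℕ), φ.Realize fun i => x i n := by
  rw [← Ultraproduct.realize_formula_cast, ← Ultraproduct.realize_formula_cast]
  exact StrongHomClass.realize_formula (shiftEquiv u) φ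
    (v := fun i => (Quotient.mk _ (x i) : Ultrapower u))

theorem eventually_mem_iff_add_one_mem {X : Set ℕ}
    (hX : Set.Definable₁ (Set.univ : Set ℕ) L0 X) :
    ∀ᶠ n in Filter.cofinite, (n ∈ X ↔ n + 1 ∈ X) := by
  obtain ⟨φ, hφ⟩ := Set.definable_iff_exists_formula_sum.1 hX
  have hmem (n : ℕ) : n ∈ X ↔ φ.Realize (Sum.elim (fun a => (a : ℕ)) fun _ => n) :=
    Set.ext_iff.1 hφ fun _ => n
  refine Filter.mem_iff_ultrafilter.2 fun u hu => ?_
  have hid : ¬ IsStandard u id := by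
    rintro ⟨c, hc⟩
    obtain ⟨n, h1, h2⟩ := (hc.and (hu (Set.finite_singleton c).compl_mem_cofinite)).exists
    exact h2 h1
  have h := eventually_realize_shiftSeq_iff (u := u) φ
    (Sum.elim (fun (a : (Set.univ : Set ℕ)) _ => (a : ℕ)) fun _ => id)
  have h1 (n : ℕ) : (fun i => Sum.elim (fun (a : (Set.univ : Set ℕ)) _ => (a : ℕ)) (fun _ => id) i n) =
      Sum.elim (fun a : (Set.univ : Set ℕ) => (a : ℕ)) fun _ : Fin 1 => n := by
    ext (a | i) <;> rfl
  have h2 (n : ℕ) :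
      (fun i => shiftSeq u (Sum.elim (fun (a : (Set.univ : Set ℕ)) _ => (a : ℕ)) (fun _ => id) i) n) =
      Sum.elim (fun a : (Set.univ : Set ℕ) => (a : ℕ)) fun _ : Fin 1 => n + 1 := by
    ext (a | i)
    · exact congrFun (shiftSeq_of_isStandard ⟨a, Filter.Eventually.of_forall fun _ => rfl⟩) n
    · exact congrFun (shiftSeq_of_not_isStandard hid) n
  simp only [h1, h2, ← hmem] at h
  by_cases hXu : ∀ᶠ n in (u : Filter ℕ), n ∈ X
  · filter_upwards [hXu, h.2 hXu] with n h3 h4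
    exact iff_of_true h3 h4
  · filter_upwards [Ultrafilter.eventually_not.2 hXu,
      Ultrafilter.eventually_not.2 fun h' => hXu (h.1 h')] with n h3 h4
    exact iff_of_false h3 h4

theorem finite_or_finite_compl_of_definable {X : Set ℕ}
    (hX : Set.Definable₁ (Set.univ : Set ℕ) L0 X) : X.Finite ∨ Xᶜ.Finite := by
  have h := eventually_mem_iff_add_one_mem hX
  rw [Nat.cofinite_eq_atTop, Filter.eventually_atTop] at h
  obtain ⟨N, hN⟩ := h
  have hconst (n : ℕ) (hn : N ≤ n) : N ∈ X ↔ n ∈ X := by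
    induction n, hn using Nat.le_induction with
    | base => rfl
    | succ n hn ih => exact ih.trans (hN n hn)
  by_cases hNX : N ∈ X
  · refine .inr ((Set.finite_lt_nat N).subset fun n hn => ?_)
    exact not_le.1 fun hle => hn ((hconst n hle).1 hNX)
  · refine .inl ((Set.finite_lt_nat N).subset fun n hn => ?_)
    exact not_le.1 fun hle => hNX ((hconst n hle).2 hn)

end L0

section TrueSentences

variable (L : FirstOrder.Language) (M : Type*) [L.Structure M]

theorem infinite_setOf_true_sentences : {A : L.Sentence | M ⊨ A}.Infinite := by
  intro hfin
  have hmaps : Set.MapsTo (fun A : L.Sentence => (⊤ : L.Sentence).imp A)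
      {A | M ⊨ A} {A | M ⊨ A} := fun A hA _ => hA
  have hinj : Set.InjOn (fun A : L.Sentence => (⊤ : L.Sentence).imp A) {A | M ⊨ A} :=
    fun A _ B _ h => (BoundedFormula.imp.inj h).2
  have hsurj := (hfin.injOn_iff_bijOn_of_mapsTo hmaps).1 hinj |>.surjOn
  obtain ⟨A, -, hA⟩ := hsurj (show (⊤ : L.Sentence) ∈ {A : L.Sentence | M ⊨ A} from id)
  exact BoundedFormula.noConfusion rfl rfl rfl (heq_of_eq (BoundedFormula.imp.inj hA).1)

theorem infinite_setOf_false_sentences : {A : L.Sentence | ¬ M ⊨ A}.Infinite := by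
  refine Set.infinite_of_injOn_mapsTo (f := fun A : L.Sentence => A.not)
    (fun A _ B _ h => (BoundedFormula.imp.inj h).1) (fun A hA hnot => ?_)
    (infinite_setOf_true_sentences L M)
  exact hnot hA

end TrueSentences

/-- For every injective Gödel numbering `ν` of `L₀`-sentences, there is no set `X ⊆ ℕ`
definable in `𝔑` (with parameters) such that for every `L₀`-sentence `A`:
`𝔑 ⊨ A` iff `ν A ∈ X`. -/
theorem no_truth_definition (ν : L0.Sentence → ℕ) (hν : Function.Injective ν) :
    ¬ ∃ X : Set ℕ, Set.Definable₁ (Set.univ : Set ℕ) L0 X ∧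
      ∀ A : L0.Sentence, (ℕ ⊨ A) ↔ ν A ∈ X := by
  rintro ⟨X, hX, hν_iff⟩
  rcases L0.finite_or_finite_compl_of_definable hX with hfin | hfin
  · exact Set.infinite_of_injOn_mapsTo hν.injOn (fun A hA => (hν_iff A).1 hA)
      (infinite_setOf_true_sentences L0 ℕ) hfin
  · exact Set.infinite_of_injOn_mapsTo hν.injOn (fun A hA => (hν_iff A).not.1 hA)
      (infinite_setOf_false_sentences L0 ℕ) hfin
end

section
/- Every set X ⊆ ℕ definable in 𝔑 is either finite or cofinite. -/
open FirstOrder FirstOrder.Language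

/-- `GapEquiv D p q` says that the differences `p j - p i` and `q j - q i` agree for all `i`, `j`
after truncation at `D`. -/
def GapEquiv {ι : Type*} (D : ℕ) (p q : ι → ℕ) : Prop :=
  ∀ i j, ∀ k ≤ D, (p i + k ≤ p j ↔ q i + k ≤ q j)

namespace GapEquiv

variable {ι κ : Type*} {D E : ℕ} {p q : ι → ℕ}

theorem symm (h : GapEquiv D p q) : GapEquiv D q p :=
  fun i j k hk => (h i j k hk).symm

theorem mono (h : GapEquiv D p q) (hE : E ≤ D) : GapEquiv E p q :=
  fun i j k hk => h i j k (hk.trans hE)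

theorem comp (h : GapEquiv D p q) (f : κ → ι) : GapEquiv D (p ∘ f) (q ∘ f) :=
  fun i j => h (f i) (f j)

theorem add_le_add_iff (h : GapEquiv D p q) (i j : ι) {k l : ℕ} (hk : k ≤ D) (hl : l < D) :
    p i + k ≤ p j + l ↔ q i + k ≤ q j + l := by
  rcases le_total l k with hlk | hkl
  · have := h i j (k - l) (by omega)
    omega
  · have := h j i (l - k + 1) (by omega)
    omega

/-- The back-and-forth step: any new point on one side can be matched on the other side, at the
cost of halving the truncation bound. -/
theorem exists_extend [Finite ι] (h : GapEquiv (2 * D + 2) p q) {z : ι}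
    (hp : p z = 0) (hq : q z = 0) (a : ℕ) :
    ∃ b, GapEquiv D (fun o : Option ι => o.elim a p) (fun o : Option ι => o.elim b q) := by
  suffices H : ∃ b, ∀ i, ∀ k ≤ D, (p i + k ≤ a ↔ q i + k ≤ b) ∧ (a + k ≤ p i ↔ b + k ≤ q i) by
    obtain ⟨b, hb⟩ := H
    refine ⟨b, ?_⟩
    rintro (_ | i) (_ | j) k hk
    · simp
    · exact (hb j k hk).2
    · exact (hb i k hk).1
    · exact h i j k (by omega)
  by_cases hnear : ∃ i, p i ≤ a + D ∧ a ≤ p i + D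
  · obtain ⟨i, hia, hai⟩ := hnear
    have hz := h z i (p i - a) (by omega)
    refine ⟨q i + a - p i, fun j k hk => ⟨?_, ?_⟩⟩
    · have := h.add_le_add_iff j i (k := k + (p i - a)) (l := a - p i) (by omega) (by omega)
      omega
    · have := h.add_le_add_iff i j (k := k + (a - p i)) (l := p i - a) (by omega) (by omega)
      omega
  · push Not at hnear
    obtain ⟨i, hi, hmax⟩ := Set.exists_max_image {i | p i ≤ a} p (Set.toFinite _)
      ⟨z, by simp [hp]⟩
    refine ⟨q i + D + 1, fun j k hk => ?_⟩
    have hi' : p i ≤ a := hi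
    have h₁ := hnear i
    have h₂ := hnear j
    have h₃ := h j i 0 (by omega)
    have h₄ := h i j (2 * D + 2) le_rfl
    have h₅ : p j ≤ a → p j ≤ p i := hmax j
    omega

end GapEquiv

/-- The values of the variables, together with the value `0` at `none`. -/
def zeroVal {ι : Type*} (v : ι → ℕ) (o : Option ι) : ℕ :=
  o.elim 0 v

/-- Every term, possibly with parameters, is a translate of a variable or of `0`. -/
theorem exists_realize_term_eq {ι : Type*} (t : (L0[[(Set.univ : Set ℕ)]]).Term ι) :
    ∃ (o : Option ι) (k : ℕ), ∀ v : ι → ℕ, t.realize v = zeroVal v o + k := by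
  induction t with
  | var i => exact ⟨some i, 0, fun v => rfl⟩
  | @func n f ts ih =>
    rcases f with f | f
    · match n, f with
      | 0, _ => exact ⟨none, 0, fun v => rfl⟩
      | 1, _ =>
        obtain ⟨o, k, h⟩ := ih 0
        refine ⟨o, k + 1, fun v => ?_⟩
        rw [← add_assoc, ← h v]
        rfl
    · match n, f with
      | 0, c => exact ⟨none, c, fun v => (zero_add _).symm⟩

/-- The truth value of a formula depends only on the truncated gaps of the valuation. -/
theorem exists_gapEquiv_realize_iff {α : Type*} [Finite α] {n : ℕ}
    (φ : (L0[[(Set.univ : Set ℕ)]]).BoundedFormula α n) :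
    ∃ D, ∀ (v w : α → ℕ) (xs ys : Fin n → ℕ),
      GapEquiv D (zeroVal (Sum.elim v xs)) (zeroVal (Sum.elim w ys)) →
        (φ.Realize v xs ↔ φ.Realize w ys) := by
  induction φ with
  | falsum => exact ⟨0, fun _ _ _ _ _ => Iff.rfl⟩
  | equal t₁ t₂ =>
    obtain ⟨i, k, hi⟩ := exists_realize_term_eq t₁
    obtain ⟨j, l, hj⟩ := exists_realize_term_eq t₂
    refine ⟨k + l + 1, fun v w xs ys h => ?_⟩
    simp only [BoundedFormula.Realize, hi, hj]
    have h₁ := h.add_le_add_iff i j (k := k) (l := l) (by omega) (by omega)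
    have h₂ := h.add_le_add_iff j i (k := l) (l := k) (by omega) (by omega)
    omega
  | @rel n m R ts =>
    rcases R with R | R
    · match m, R with
      | 2, _ =>
        obtain ⟨i, k, hi⟩ := exists_realize_term_eq (ts 0)
        obtain ⟨j, l, hj⟩ := exists_realize_term_eq (ts 1)
        refine ⟨k + l + 1, fun v w xs ys h => ?_⟩
        change (ts 0).realize (Sum.elim v xs) < (ts 1).realize (Sum.elim v xs) ↔
          (ts 0).realize (Sum.elim w ys) < (ts 1).realize (Sum.elim w ys)
        simp only [hi, hj]
        have := h.add_le_add_iff j i (k := l) (l := k) (by omega) (by omega)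
        omega
    · exact isEmptyElim R
  | imp φ ψ hφ hψ =>
    obtain ⟨D, hD⟩ := hφ
    obtain ⟨E, hE⟩ := hψ
    refine ⟨max D E, fun v w xs ys h => ?_⟩
    exact imp_congr (hD _ _ _ _ (h.mono (le_max_left _ _)))
      (hE _ _ _ _ (h.mono (le_max_right _ _)))
  | @all n φ hφ =>
    obtain ⟨D, hD⟩ := hφ
    have key : ∀ (v w : α → ℕ) (xs ys : Fin n → ℕ),
        GapEquiv (2 * D + 2) (zeroVal (Sum.elim v xs)) (zeroVal (Sum.elim w ys)) →
          ∀ a, ∃ b, φ.Realize v (Fin.snoc xs a) ↔ φ.Realize w (Fin.snoc ys b) := by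
      intro v w xs ys h a
      obtain ⟨b, hb⟩ := h.exists_extend (z := none) rfl rfl a
      refine ⟨b, hD _ _ _ _ ?_⟩
      let f : Option (α ⊕ Fin (n + 1)) → Option (Option (α ⊕ Fin n)) := fun o =>
        o.elim (some none) (Sum.elim (fun i => some (some (.inl i)))
          (Fin.snoc (fun i => some (some (.inr i))) none))
      have hf : ∀ (v : α → ℕ) (xs : Fin n → ℕ) (a : ℕ),
          zeroVal (Sum.elim v (Fin.snoc xs a)) =
            (fun o => o.elim a (zeroVal (Sum.elim v xs))) ∘ f := by
        intro v xs a
        funext o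
        rcases o with _ | i | i
        · rfl
        · rfl
        · refine Fin.lastCases ?_ (fun i => ?_) i <;> simp [zeroVal, f]
      rw [hf, hf]
      exact hb.comp f
    refine ⟨2 * D + 2, fun v w xs ys h => ⟨fun H b => ?_, fun H a => ?_⟩⟩
    · obtain ⟨a, ha⟩ := key _ _ _ _ h.symm b
      exact ha.2 (H a)
    · obtain ⟨b, hb⟩ := key _ _ _ _ h a
      exact hb.2 (H b)

/-- Every subset of `ℕ` definable in `𝔑` (with parameters) is finite or cofinite. -/
theorem definable_finite_or_cofinite (X : Set ℕ)
    (hX : Set.Definable₁ (Set.univ : Set ℕ) L0 X) :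
    X.Finite ∨ Xᶜ.Finite := by
  obtain ⟨φ, hφ⟩ := hX
  obtain ⟨D, hD⟩ := exists_gapEquiv_realize_iff φ
  have hmem : ∀ x, x ∈ X ↔ φ.Realize fun _ : Fin 1 => x := fun x =>
    Set.ext_iff.1 hφ fun _ => x
  have hlarge : ∀ x, D + 1 ≤ x → (x ∈ X ↔ D + 1 ∈ X) := by
    intro x hx
    rw [hmem, hmem]
    refine hD _ _ _ _ ?_
    rintro (_ | i | i) (_ | j | j) k hk
    all_goals try first | exact i.elim0 | exact j.elim0
    all_goals simp only [zeroVal, Option.elim, Sum.elim_inl] <;> omega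
  by_cases hDX : D + 1 ∈ X
  · refine .inr ((Set.finite_Iio (D + 1)).subset fun x hx => ?_)
    exact not_le.1 fun hle => hx ((hlarge x hle).2 hDX)
  · refine .inl ((Set.finite_Iio (D + 1)).subset fun x hx => ?_)
    exact not_le.1 fun hle => hDX ((hlarge x hle).1 hx)
end

section
/- The finitely axiomatized theory A_W proves full induction: for every L₀-formula φ(x, y₁, …, y_k), every model M of A_W, and all parameters b₁, …, b_k ∈ M, if M ⊨ φ(0, b̄) and for all a ∈ M, M ⊨ φ(a, b̄) implies M ⊨ φ(S a, b̄), then M ⊨ φ(a, b̄) for all a ∈ M. -/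
open FirstOrder FirstOrder.Language

/-- The atomic formula `t₁ < t₂`. -/
def ltF {n : ℕ} (t₁ t₂ : L0.Term (Empty ⊕ Fin n)) : L0.BoundedFormula Empty n :=
  Relations.boundedFormula₂ (show L0.Relations 2 from Unit.unit) t₁ t₂

/-- The term `0`. -/
def zeroT {α : Type} : L0.Term α := Constants.term (show L0.Constants from Unit.unit)

/-- The term `S t`. -/
def succT {α : Type} (t : L0.Term α) : L0.Term α :=
  Functions.apply₁ (show L0.Functions 1 from Unit.unit) t

/-- `<` is irreflexive. -/
def axIrrefl : L0.Sentence := ∀' ∼(ltF &0 &0)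

/-- `<` is transitive. -/
def axTrans : L0.Sentence := ∀' ∀' ∀' ((ltF &0 &1 ⊓ ltF &1 &2) ⟹ ltF &0 &2)

/-- `<` is total: `∀x∀y (x < y ∨ x = y ∨ y < x)`. -/
def axTotal : L0.Sentence := ∀' ∀' (ltF &0 &1 ⊔ (Term.bdEqual &0 &1) ⊔ ltF &1 &0)

/-- `∀x ¬(x < 0)`. -/
def axZero : L0.Sentence := ∀' ∼(ltF &0 zeroT)

/-- `∀x (x < S x ∧ ¬∃y (x < y ∧ y < S x))`. -/
def axSucc : L0.Sentence := ∀' (ltF &0 (succT &0) ⊓ ∼(∃' (ltF &0 &1 ⊓ ltF &1 (succT &0))))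

/-- `∀x (x ≠ 0 → ∃y (S y = x))`. -/
def axPred : L0.Sentence := ∀' (∼(Term.bdEqual &0 zeroT) ⟹ ∃' (Term.bdEqual (succT &1) &0))

/-- The finite theory `A_W`. -/
def AW : L0.Theory := {axIrrefl, axTrans, axTotal, axZero, axSucc, axPred}

/-- The interpretation of the constant `0` in an `L₀`-structure `M`. -/
def zeroM (M : Type*) [L0.Structure M] : M :=
  Structure.funMap (show L0.Functions 0 from Unit.unit) ![]

/-- The interpretation of the function `S` in an `L₀`-structure `M`. -/
def succM {M : Type*} [L0.Structure M] (a : M) : M :=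
  Structure.funMap (show L0.Functions 1 from Unit.unit) ![a]

/-- An `L₀`-structure whose symbols are interpreted by a discrete linear order with least element,
without greatest element, in which every nonzero element is a successor. -/
class IsDiscreteModel (M : Type*) [L0.Structure M] [LinearOrder M] [OrderBot M] [SuccOrder M] :
    Prop where
  zero_eq : zeroM M = ⊥
  succ_eq : ∀ a : M, succM a = Order.succ a
  relMap_iff : ∀ (r : L0.Relations 2) (x : Fin 2 → M), Structure.RelMap r x ↔ x 0 < x 1
  exists_succ_eq : ∀ a : M, a ≠ ⊥ → ∃ b, Order.succ b = a

section Order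

variable {M N : Type*} [LinearOrder M] [SuccOrder M] [LinearOrder N] [SuccOrder N]

theorem iterate_succ_mono {x y : M} {m n : ℕ} (hmn : m ≤ n) (hxy : x ≤ y) :
    Order.succ^[m] x ≤ Order.succ^[n] y :=
  ((Order.succ_mono.iterate m) hxy).trans
    (Function.monotone_iterate_of_id_le Order.le_succ hmn y)

theorem iterate_succ_lt_of_ne {x a : M} {n : ℕ} (hx : x ≤ a)
    (h : ∀ m ≤ n, Order.succ^[m] x ≠ a) : Order.succ^[n] x < a := by
  induction n with
  | zero => exact lt_of_le_of_ne hx (h 0 le_rfl)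
  | succ n ih =>
    refine lt_of_le_of_ne ?_ (h _ le_rfl)
    rw [Function.iterate_succ_apply']
    exact Order.succ_le_of_lt (ih fun m hm => h m (hm.trans n.le_succ))

/-- The correspondence `R` preserves the order and distances up to `n`. -/
def PreservesDist (n : ℕ) (R : Set (M × N)) : Prop :=
  ∀ p ∈ R, ∀ q ∈ R, ∀ k ≤ n, Order.succ^[k] p.1 < q.1 ↔ Order.succ^[k] p.2 < q.2

namespace PreservesDist

theorem mono {m n : ℕ} {R : Set (M × N)} (h : PreservesDist n R) (hmn : m ≤ n) :
    PreservesDist m R :=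
  fun p hp q hq k hk => h p hp q hq k (hk.trans hmn)

theorem swap {n : ℕ} {R : Set (M × N)} (h : PreservesDist n R) :
    PreservesDist n (Prod.swap '' R) := by
  rintro _ ⟨p, hp, rfl⟩ _ ⟨q, hq, rfl⟩ k hk
  exact (h p hp q hq k hk).symm

theorem singleton_bot [OrderBot M] [OrderBot N] (n : ℕ) :
    PreservesDist n {((⊥ : M), (⊥ : N))} := by
  rintro _ rfl _ rfl k -
  simp

theorem insert {n : ℕ} {R : Set (M × N)} (h : PreservesDist n R) {a : M} {b : N}
    (hab : ∀ p ∈ R, ∀ k ≤ n, (Order.succ^[k] p.1 < a ↔ Order.succ^[k] p.2 < b) ∧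
      (Order.succ^[k] a < p.1 ↔ Order.succ^[k] b < p.2)) :
    PreservesDist n (insert (a, b) R) := by
  rintro p (rfl | hp) q (rfl | hq) k hk
  · exact iff_of_false (Order.le_succ_iterate k a).not_gt (Order.le_succ_iterate k b).not_gt
  · exact (hab q hq k hk).2
  · exact (hab p hp k hk).1
  · exact h p hp q hq k hk

end PreservesDist

variable [NoMaxOrder M] [NoMaxOrder N]

theorem iterate_succ_lt_iterate_succ {x y : M} (n : ℕ) :
    Order.succ^[n] x < Order.succ^[n] y ↔ x < y :=
  (Order.succ_strictMono.iterate n).lt_iff_lt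

theorem iterate_succ_le_iterate_succ {x y : M} (n : ℕ) :
    Order.succ^[n] x ≤ Order.succ^[n] y ↔ x ≤ y :=
  (Order.succ_strictMono.iterate n).le_iff_le

theorem lt_iterate_succ_succ {x y : M} (n : ℕ) :
    x < Order.succ^[n + 1] y ↔ ¬ Order.succ^[n] y < x := by
  rw [Function.iterate_succ_apply', Order.lt_succ_iff, not_lt]

theorem exists_iterate_succ_eq [OrderBot M] (hM : ∀ a : M, a ≠ ⊥ → ∃ b, Order.succ b = a)
    {n : ℕ} {y : M} (h : Order.succ^[n] ⊥ ≤ y) : ∃ x, Order.succ^[n] x = y := by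
  induction n generalizing y with
  | zero => exact ⟨y, rfl⟩
  | succ n ih =>
    rw [Function.iterate_succ_apply'] at h
    obtain ⟨z, rfl⟩ := hM y ((bot_le.trans_lt (Order.lt_succ _)).trans_le h).ne'
    obtain ⟨x, rfl⟩ := ih (Order.succ_le_succ_iff.1 h)
    exact ⟨x, Function.iterate_succ_apply' _ _ _⟩

namespace PreservesDist

theorem iterate_lt_iff {n : ℕ} {R : Set (M × N)} (h : PreservesDist n R) {p q : M × N}
    (hp : p ∈ R) (hq : q ∈ R) {k l : ℕ} (hk : k ≤ n) (hl : l ≤ n) :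
    Order.succ^[k] p.1 < Order.succ^[l] q.1 ↔ Order.succ^[k] p.2 < Order.succ^[l] q.2 := by
  rcases le_or_gt l k with hlk | hlk
  · obtain ⟨d, rfl⟩ := Nat.exists_eq_add_of_le hlk
    rw [Function.iterate_add_apply, Function.iterate_add_apply, iterate_succ_lt_iterate_succ,
      iterate_succ_lt_iterate_succ]
    exact h p hp q hq d (by omega)
  · obtain ⟨d, rfl⟩ := Nat.exists_eq_add_of_lt hlk
    rw [add_assoc, Function.iterate_add_apply _ k (d + 1), Function.iterate_add_apply _ k (d + 1),
      iterate_succ_lt_iterate_succ, iterate_succ_lt_iterate_succ, lt_iterate_succ_succ,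
      lt_iterate_succ_succ, h q hq p hp d (by omega)]

theorem iterate_eq_iff {n : ℕ} {R : Set (M × N)} (h : PreservesDist n R) {p q : M × N}
    (hp : p ∈ R) (hq : q ∈ R) {k l : ℕ} (hk : k ≤ n) (hl : l ≤ n) :
    Order.succ^[k] p.1 = Order.succ^[l] q.1 ↔ Order.succ^[k] p.2 = Order.succ^[l] q.2 := by
  simp only [le_antisymm_iff, ← not_lt, h.iterate_lt_iff hp hq hk hl,
    h.iterate_lt_iff hq hp hl hk]

theorem exists_insert [OrderBot M] [OrderBot N]
    (hN : ∀ b : N, b ≠ ⊥ → ∃ c, Order.succ c = b) {n : ℕ} {R : Set (M × N)}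
    (h : PreservesDist (2 * n + 1) R) (hR : R.Finite) (hbot : (⊥, ⊥) ∈ R) (a : M) :
    ∃ b : N, PreservesDist n (Insert.insert (a, b) R) := by
  suffices ∃ b : N, ∀ p ∈ R, ∀ k ≤ n, (Order.succ^[k] p.1 < a ↔ Order.succ^[k] p.2 < b) ∧
      (Order.succ^[k] a < p.1 ↔ Order.succ^[k] b < p.2) from
    this.imp fun b hb => (h.mono (by omega)).insert hb
  by_cases hup : ∃ q ∈ R, ∃ m ≤ n, Order.succ^[m] q.1 = a
  · obtain ⟨q, hq, m, hm, rfl⟩ := hup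
    refine ⟨Order.succ^[m] q.2, fun p hp k hk => ⟨?_, ?_⟩⟩
    · exact h.iterate_lt_iff hp hq (by omega) (by omega)
    · rw [← Function.iterate_add_apply, ← Function.iterate_add_apply]
      exact h q hq p hp _ (by omega)
  by_cases hdown : ∃ q ∈ R, ∃ m ≤ n, Order.succ^[m] a = q.1
  · obtain ⟨q, hq, m, hm, hqa⟩ := hdown
    have hle : Order.succ^[m] (⊥ : N) ≤ q.2 := by
      have := h.iterate_lt_iff hq hbot (k := 0) (l := m) (by omega) (by omega)
      rw [← not_lt]
      refine this.not.1 (not_lt.2 ?_)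
      exact ((iterate_succ_le_iterate_succ m).2 bot_le).trans hqa.le
    obtain ⟨b, hb⟩ := exists_iterate_succ_eq hN hle
    refine ⟨b, fun p hp k hk => ⟨?_, ?_⟩⟩
    · rw [← iterate_succ_lt_iterate_succ m, ← iterate_succ_lt_iterate_succ (y := b) m, hqa, hb,
        ← Function.iterate_add_apply, ← Function.iterate_add_apply]
      exact h p hp q hq _ (by omega)
    · rw [← iterate_succ_lt_iterate_succ m, ← iterate_succ_lt_iterate_succ (x := _^[k] b) m,
        ← Function.iterate_add_apply, ← Function.iterate_add_apply, add_comm m k,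
        Function.iterate_add_apply, Function.iterate_add_apply, hqa, hb]
      exact h.iterate_lt_iff hq hp (by omega) (by omega)
  push Not at hup hdown
  obtain ⟨p, ⟨hp, hpa⟩, hmax⟩ := (hR.subset (Set.sep_subset R fun p => p.1 ≤ a)).exists_maximalFor
    Prod.fst _ ⟨_, hbot, bot_le⟩
  have hpn : Order.succ^[n] p.1 < a := iterate_succ_lt_of_ne hpa (hup p hp)
  refine ⟨Order.succ^[n + 1] p.2, fun q hq k hk => ?_⟩
  rcases le_or_gt q.1 a with hqa | hqa
  · have hqp : q.1 ≤ p.1 := (le_total q.1 p.1).elim id (hmax ⟨hq, hqa⟩)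
    have hqp' : q.2 ≤ p.2 := not_lt.1 ((h p hp q hq 0 (by omega)).not.1 hqp.not_gt)
    refine ⟨iff_of_true ((iterate_succ_mono hk hqp).trans_lt hpn) ?_, iff_of_false ?_ ?_⟩
    · refine (iterate_succ_mono hk hqp').trans_lt ?_
      rw [Function.iterate_succ_apply']
      exact Order.lt_succ _
    · exact (hqa.trans (Order.le_succ_iterate k a)).not_gt
    · exact ((hqp'.trans (Order.le_succ_iterate _ _)).trans (Order.le_succ_iterate k _)).not_gt
  · have hqn : Order.succ^[n] a < q.1 := iterate_succ_lt_of_ne hqa.le (hdown q hq)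
    have hqn' : Order.succ^[n] (Order.succ^[n + 1] p.2) < q.2 := by
      rw [← Function.iterate_add_apply, ← h p hp q hq _ (by omega), Function.iterate_add_apply]
      refine lt_of_le_of_lt ((iterate_succ_le_iterate_succ n).2 ?_) hqn
      rw [Function.iterate_succ_apply']
      exact Order.succ_le_of_lt hpn
    refine ⟨iff_of_false ?_ ?_, iff_of_true ?_ ?_⟩
    · exact (hqa.le.trans (Order.le_succ_iterate k _)).not_gt
    · exact (((Order.le_succ_iterate n _).trans hqn'.le).trans (Order.le_succ_iterate k _)).not_gt
    · exact (iterate_succ_mono hk le_rfl).trans_lt hqn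
    · exact (iterate_succ_mono hk le_rfl).trans_lt hqn'

theorem exists_insert_swap [OrderBot M] [OrderBot N]
    (hM : ∀ a : M, a ≠ ⊥ → ∃ c, Order.succ c = a) {n : ℕ} {R : Set (M × N)}
    (h : PreservesDist (2 * n + 1) R) (hR : R.Finite) (hbot : (⊥, ⊥) ∈ R) (b : N) :
    ∃ a : M, PreservesDist n (Insert.insert (a, b) R) := by
  obtain ⟨a, ha⟩ := h.swap.exists_insert hM (hR.image _) ⟨_, hbot, rfl⟩ b
  refine ⟨a, ?_⟩
  have := ha.swap
  rwa [Set.image_insert_eq, Set.image_image, Prod.swap_prod_mk,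
    show (fun x : M × N => x.swap.swap) = id from rfl, Set.image_id] at this

/-- Every finite set is the domain of a finite correspondence preserving distances up to `n`. -/
theorem exists_of_finset [OrderBot M] [OrderBot N]
    (hN : ∀ b : N, b ≠ ⊥ → ∃ c, Order.succ c = b) (s : Finset M) (n : ℕ) :
    ∃ R : Set (M × N), R.Finite ∧ (⊥, ⊥) ∈ R ∧ PreservesDist n R ∧
      ∀ x ∈ s, ∃ y, (x, y) ∈ R := by
  induction s using Finset.induction_on generalizing n with
  | empty => exact ⟨_, Set.finite_singleton _, rfl, singleton_bot n, by simp⟩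
  | insert a s _ ih =>
    obtain ⟨R, hR, hbot, h, hs⟩ := ih (2 * n + 1)
    obtain ⟨b, hb⟩ := h.exists_insert hN hR hbot a
    refine ⟨_, hR.insert _, Set.mem_insert_of_mem _ hbot, hb, fun x hx => ?_⟩
    rcases Finset.mem_insert.1 hx with rfl | hx
    · exact ⟨b, Set.mem_insert _ _⟩
    · exact (hs x hx).imp fun y hy => Set.mem_insert_of_mem _ hy

end PreservesDist

end Order

section Realize

variable {M N : Type*} [L0.Structure M] [LinearOrder M] [OrderBot M] [SuccOrder M]
  [IsDiscreteModel M] [L0.Structure N] [LinearOrder N] [OrderBot N] [SuccOrder N]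
  [IsDiscreteModel N]

/-- Each term is an iterated successor of a variable or of `0`, uniformly in two models. -/
theorem exists_realize_eq_iterate_succ {β : Type*} (t : L0.Term β) :
    ∃ k : ℕ, ∀ (R : Set (M × N)), (⊥, ⊥) ∈ R → ∀ (v : β → M) (w : β → N),
      (∀ i, (v i, w i) ∈ R) → ∃ p ∈ R,
        t.realize v = Order.succ^[k] p.1 ∧ t.realize w = Order.succ^[k] p.2 := by
  induction t with
  | var i => exact ⟨0, fun R _ v w h => ⟨_, h i, rfl, rfl⟩⟩
  | @func l f ts ih =>
    match l, f, ts, ih with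
    | 0, f, ts, ih =>
      refine ⟨0, fun R hbot v w h => ⟨_, hbot, ?_, ?_⟩⟩
      · refine Eq.trans ?_ (IsDiscreteModel.zero_eq (M := M))
        exact congrArg (Structure.funMap f) (Subsingleton.elim _ _)
      · refine Eq.trans ?_ (IsDiscreteModel.zero_eq (M := N))
        exact congrArg (Structure.funMap f) (Subsingleton.elim _ _)
    | 1, f, ts, ih =>
      obtain ⟨k, hk⟩ := ih 0
      refine ⟨k + 1, fun R hbot v w h => ?_⟩
      obtain ⟨p, hp, h1, h2⟩ := hk R hbot v w h
      refine ⟨p, hp, ?_, ?_⟩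
      · rw [Function.iterate_succ_apply', ← h1, ← IsDiscreteModel.succ_eq]
        exact congrArg (Structure.funMap f) (funext fun i => by rw [Subsingleton.elim i 0]; rfl)
      · rw [Function.iterate_succ_apply', ← h2, ← IsDiscreteModel.succ_eq]
        exact congrArg (Structure.funMap f) (funext fun i => by rw [Subsingleton.elim i 0]; rfl)

variable (M N) in
/-- The truth of a formula depends only on the order and on distances up to a fixed bound. -/
theorem exists_realize_iff_of_preservesDist [NoMaxOrder M] [NoMaxOrder N] {α : Type*} {m : ℕ}
    (φ : L0.BoundedFormula α m) :
    ∃ n : ℕ, ∀ (R : Set (M × N)), R.Finite → (⊥, ⊥) ∈ R → PreservesDist n R →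
      ∀ (v : α → M) (w : α → N) (x : Fin m → M) (y : Fin m → N),
        (∀ i, (v i, w i) ∈ R) → (∀ i, (x i, y i) ∈ R) → (φ.Realize v x ↔ φ.Realize w y) := by
  induction φ with
  | falsum => exact ⟨0, fun _ _ _ _ _ _ _ _ _ _ => Iff.rfl⟩
  | equal t₁ t₂ =>
    obtain ⟨k, hk⟩ := exists_realize_eq_iterate_succ (M := M) (N := N) t₁
    obtain ⟨l, hl⟩ := exists_realize_eq_iterate_succ (M := M) (N := N) t₂
    refine ⟨max k l, fun R _ hbot h v w x y hv hx => ?_⟩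
    have hvx : ∀ i, (Sum.elim v x i, Sum.elim w y i) ∈ R := Sum.rec hv hx
    obtain ⟨p, hp, hp₁, hp₂⟩ := hk R hbot _ _ hvx
    obtain ⟨q, hq, hq₁, hq₂⟩ := hl R hbot _ _ hvx
    simp only [BoundedFormula.Realize, hp₁, hp₂, hq₁, hq₂]
    exact h.iterate_eq_iff hp hq (le_max_left _ _) (le_max_right _ _)
  | @rel _ l r ts =>
    match l, r, ts with
    | 2, r, ts =>
      obtain ⟨k, hk⟩ := exists_realize_eq_iterate_succ (M := M) (N := N) (ts 0)
      obtain ⟨l, hl⟩ := exists_realize_eq_iterate_succ (M := M) (N := N) (ts 1)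
      refine ⟨max k l, fun R _ hbot h v w x y hv hx => ?_⟩
      have hvx : ∀ i, (Sum.elim v x i, Sum.elim w y i) ∈ R := Sum.rec hv hx
      obtain ⟨p, hp, hp₁, hp₂⟩ := hk R hbot _ _ hvx
      obtain ⟨q, hq, hq₁, hq₂⟩ := hl R hbot _ _ hvx
      simp only [BoundedFormula.Realize, IsDiscreteModel.relMap_iff, hp₁, hp₂, hq₁, hq₂]
      exact h.iterate_lt_iff hp hq (le_max_left _ _) (le_max_right _ _)
  | imp φ ψ ihφ ihψ =>
    obtain ⟨k, hk⟩ := ihφ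
    obtain ⟨l, hl⟩ := ihψ
    refine ⟨max k l, fun R hR hbot h v w x y hv hx => ?_⟩
    exact imp_congr (hk R hR hbot (h.mono (le_max_left _ _)) v w x y hv hx)
      (hl R hR hbot (h.mono (le_max_right _ _)) v w x y hv hx)
  | all φ ih =>
    obtain ⟨n, hn⟩ := ih
    refine ⟨2 * n + 1, fun R hR hbot h v w x y hv hx => ?_⟩
    have key : ∀ a b, PreservesDist n (insert (a, b) R) →
        (φ.Realize v (Fin.snoc x a) ↔ φ.Realize w (Fin.snoc y b)) := by
      intro a b hab
      refine hn _ (hR.insert _) (Set.mem_insert_of_mem _ hbot) hab v w _ _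
        (fun i => Set.mem_insert_of_mem _ (hv i)) (Fin.lastCases ?_ fun i => ?_)
      · simp
      · simpa using Or.inr (hx i)
    constructor
    · intro H b
      obtain ⟨a, ha⟩ := h.exists_insert_swap IsDiscreteModel.exists_succ_eq hR hbot b
      exact (key a b ha).1 (H a)
    · intro H a
      obtain ⟨b, hb⟩ := h.exists_insert IsDiscreteModel.exists_succ_eq hR hbot a
      exact (key a b hb).2 (H b)

end Realize

instance : IsDiscreteModel ℕ where
  zero_eq := rfl
  succ_eq _ := rfl
  relMap_iff _ _ := Iff.rfl
  exists_succ_eq a ha := ⟨a - 1, Nat.succ_pred_eq_of_ne_zero ha⟩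

theorem IsDiscreteModel.induction {M : Type*} [L0.Structure M] [LinearOrder M] [OrderBot M]
    [SuccOrder M] [NoMaxOrder M] [IsDiscreteModel M] {α : Type*} [Finite α]
    (φ : L0.BoundedFormula α 1) (b : α → M) (h0 : φ.Realize b ![⊥])
    (hS : ∀ a : M, φ.Realize b ![a] → φ.Realize b ![Order.succ a]) (a : M) :
    φ.Realize b ![a] := by
  obtain ⟨n, hn⟩ := exists_realize_iff_of_preservesDist M ℕ φ
  obtain ⟨R, hR, hbot, h, hb⟩ := PreservesDist.exists_of_finset (N := ℕ)
    IsDiscreteModel.exists_succ_eq (Set.finite_range b).toFinset (2 * (2 * (n + 1) + 1) + 1)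
  choose c hc using fun i => hb (b i) (by simp)
  have key : ∀ R' : Set (M × ℕ), R'.Finite → R ⊆ R' → PreservesDist n R' →
      ∀ x y, (x, y) ∈ R' → (φ.Realize b ![x] ↔ φ.Realize c ![y]) := by
    intro R' hfin hsub h' x y hxy
    exact hn R' hfin (hsub hbot) h' b c _ _ (fun i => hsub (hc i)) (by simpa using hxy)
  have hnat : ∀ y : ℕ, φ.Realize c ![y] := by
    intro y
    induction y with
    | zero => exact (key R hR subset_rfl (h.mono (by omega)) _ _ hbot).1 h0
    | succ y ih =>
      obtain ⟨x, hx⟩ := h.exists_insert_swap IsDiscreteModel.exists_succ_eq hR hbot y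
      obtain ⟨x', hx'⟩ := hx.exists_insert_swap IsDiscreteModel.exists_succ_eq (hR.insert _)
        (Set.mem_insert_of_mem _ hbot) (y + 1)
      have hsub := (Set.subset_insert (x, y) R).trans (Set.subset_insert (x', y + 1) _)
      have hkey := key _ ((hR.insert _).insert _) hsub (hx'.mono (by omega))
      have hxm : (x, y) ∈ insert (x', y + 1) (insert (x, y) R) := by simp
      have hxm' : (x', y + 1) ∈ insert (x', y + 1) (insert (x, y) R) := by simp
      have hsucc : Order.succ x = x' :=
        (hx'.iterate_eq_iff hxm hxm' (k := 1) (l := 0) (by omega) (by omega)).2 rfl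
      exact (hkey _ _ hxm').1 (hsucc ▸ hS x ((hkey _ _ hxm).2 ih))
  obtain ⟨y, hy⟩ := h.exists_insert IsDiscreteModel.exists_succ_eq hR hbot a
  exact (key _ (hR.insert _) (Set.subset_insert _ _) (hy.mono (by omega)) a y
    (Set.mem_insert _ _)).2 (hnat y)

section Axioms

variable {M : Type*} [L0.Structure M]

/-- The interpretation of `<` in an `L₀`-structure. -/
def ltM (a b : M) : Prop :=
  Structure.RelMap (show L0.Relations 2 from Unit.unit) ![a, b]

theorem realize_ltF {n : ℕ} (t₁ t₂ : L0.Term (Empty ⊕ Fin n)) (v : Empty → M) (x : Fin n → M) :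
    (ltF t₁ t₂).Realize v x ↔ ltM (t₁.realize (Sum.elim v x)) (t₂.realize (Sum.elim v x)) :=
  BoundedFormula.realize_rel₂

theorem realize_zeroT {α : Type} (v : α → M) : (zeroT : L0.Term α).realize v = zeroM M :=
  congrArg (Structure.funMap _) (Subsingleton.elim _ _)

theorem realize_succT {α : Type} (t : L0.Term α) (v : α → M) :
    (succT t).realize v = succM (t.realize v) :=
  Term.realize_functions_apply₁

theorem model_AW_iff : M ⊨ AW ↔
    (∀ a : M, ¬ ltM a a) ∧ (∀ a b c : M, ltM a b → ltM b c → ltM a c) ∧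
      (∀ a b : M, (ltM a b ∨ a = b) ∨ ltM b a) ∧ (∀ a : M, ¬ ltM a (zeroM M)) ∧
      (∀ a : M, ltM a (succM a) ∧ ∀ b, ltM a b → ¬ ltM b (succM a)) ∧
      (∀ a : M, a ≠ zeroM M → ∃ b, succM b = a) := by
  simp [AW, Theory.model_iff, axIrrefl, axTrans, axTotal, axZero, axSucc, axPred,
    Sentence.Realize, Formula.Realize, realize_ltF, realize_zeroT, realize_succT, Fin.snoc]

end Axioms

/-- `A_W` proves full induction: for every `L₀`-formula `φ(x, y₁, …, y_k)`, every model
`M` of `A_W`, and all parameters `b : Fin k → M`, if `φ(0, b̄)` holds and `φ(a, b̄)`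
implies `φ(S a, b̄)` for all `a`, then `φ(a, b̄)` holds for all `a ∈ M`. -/
theorem AW_proves_induction (M : Type*) [L0.Structure M] (hM : M ⊨ AW)
    (k : ℕ) (φ : L0.BoundedFormula (Fin k) 1) (b : Fin k → M)
    (h0 : φ.Realize b ![zeroM M])
    (hS : ∀ a : M, φ.Realize b ![a] → φ.Realize b ![succM a]) :
    ∀ a : M, φ.Realize b ![a] := by
  obtain ⟨hirrefl, htrans, htotal, hzero, hsucc, hpred⟩ := model_AW_iff.1 hM
  classical
  let : LinearOrder M :=
    { lt := ltM
      le := fun a b => ltM a b ∨ a = b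
      le_refl := fun a => Or.inr rfl
      le_trans := by grind
      lt_iff_le_not_ge := by grind
      le_antisymm := by grind
      le_total := by grind
      toDecidableLE := Classical.decRel _ }
  have lt_def : ∀ a b : M, a < b ↔ ltM a b := fun _ _ => Iff.rfl
  let : OrderBot M :=
    { bot := zeroM M
      bot_le := fun a => not_lt.1 (hzero a) }
  let : SuccOrder M := SuccOrder.ofSuccLeIff succM fun {a b} =>
    ⟨((lt_def _ _).2 (hsucc a).1).trans_le, fun h => not_lt.1 ((hsucc a).2 b h)⟩
  have : NoMaxOrder M := ⟨fun a => ⟨succM a, (hsucc a).1⟩⟩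
  have : IsDiscreteModel M :=
    { zero_eq := rfl
      succ_eq := fun _ => rfl
      relMap_iff := fun r x =>
        iff_of_eq (congrArg (Structure.RelMap r) (List.ofFn_injective rfl))
      exists_succ_eq := hpred }
  exact IsDiscreteModel.induction φ b h0 hS
end

section
/- Let D = {(x,y) ∈ ℕ × ℕ : y = x ∨ y = x+1}, and let 𝔇 be the L₁-structure on D with: constant (0,0); successor s given by s(x,x) = (x, x+1) and s(x, x+1) = (x+1, x+1); order (x,y) ≺ (x',y') iff x < x' ∨ (x = x' ∧ y < y'); and predicate E_D = {(x,y) ∈ D : x = y}. Then the map h : D → ℕ with h(x,x) = 2x and h(x, x+1) = 2x+1 is an isomorphism of L₁-structures from 𝔇 onto 𝔑_E. (This is the semantic content of the two-dimensional interpretation of W' = Th(𝔑_E) in W = Th(𝔑).) -/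
open FirstOrder FirstOrder.Language


/-- The language `L₁` with a constant `0`, a unary function `S`, a unary predicate `E`,
and a binary relation `<`. -/
def L1 : FirstOrder.Language where
  Functions n := match n with
    | 0 => Unit
    | 1 => Unit
    | _ => Empty
  Relations n := match n with
    | 1 => Unit
    | 2 => Unit
    | _ => Empty

/-- The structure `𝔑_E = (ℕ; 0, n ↦ n + 1, <, even numbers)`. -/
instance natL1 : L1.Structure ℕ where
  funMap {n} f x :=
    match n, f with
    | 0, _ => 0
    | 1, _ => x 0 + 1
  RelMap {n} r x :=
    match n, r with
    | 1, _ => Even (x 0)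
    | 2, _ => x 0 < x 1

/-- The domain `D = {(x, y) ∈ ℕ × ℕ : y = x ∨ y = x + 1}`. -/
def D : Type := {p : ℕ × ℕ // p.2 = p.1 ∨ p.2 = p.1 + 1}

/-- The successor operation on `D`: `s(x,x) = (x, x+1)` and `s(x, x+1) = (x+1, x+1)`. -/
def succD (d : D) : D :=
  if d.1.2 = d.1.1 then ⟨(d.1.1, d.1.1 + 1), Or.inr rfl⟩
  else ⟨(d.1.1 + 1, d.1.1 + 1), Or.inl rfl⟩

/-- The structure `𝔇` on `D`. -/
instance structD : L1.Structure D where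
  funMap {n} f x :=
    match n, f with
    | 0, _ => ⟨(0, 0), Or.inl rfl⟩
    | 1, _ => succD (x 0)
  RelMap {n} r x :=
    match n, r with
    | 1, _ => (x 0).1.1 = (x 0).1.2
    | 2, _ => (x 0).1.1 < (x 1).1.1 ∨ ((x 0).1.1 = (x 1).1.1 ∧ (x 0).1.2 < (x 1).1.2)

/-- The map `h : D → ℕ` with `h(x, x) = 2x` and `h(x, x+1) = 2x + 1`. -/
def hMap (d : D) : ℕ := if d.1.2 = d.1.1 then 2 * d.1.1 else 2 * d.1.1 + 1
theorem hMap_eq_add (d : D) : hMap d = d.1.1 + d.1.2 := by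
  have h := d.2
  unfold hMap
  split_ifs <;> omega

theorem hMap_succD (d : D) : hMap (succD d) = hMap d + 1 := by
  have h := d.2
  rw [hMap_eq_add, hMap_eq_add]
  by_cases hd : d.1.2 = d.1.1
  · have hs : (succD d).1 = (d.1.1, d.1.1 + 1) := congrArg Subtype.val (if_pos hd)
    rw [hs]
    omega
  · have hs : (succD d).1 = (d.1.1 + 1, d.1.1 + 1) := congrArg Subtype.val (if_neg hd)
    rw [hs]
    omega

theorem even_hMap_iff (d : D) : Even (hMap d) ↔ d.1.1 = d.1.2 := by
  have h := d.2
  rw [hMap_eq_add, Nat.even_iff]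
  omega

theorem hMap_lt_iff (d d' : D) :
    hMap d < hMap d' ↔ d.1.1 < d'.1.1 ∨ (d.1.1 = d'.1.1 ∧ d.1.2 < d'.1.2) := by
  have h := d.2
  have h' := d'.2
  rw [hMap_eq_add, hMap_eq_add]
  omega

/-- The bijection `hMap`, with inverse `n ↦ (⌊n / 2⌋, ⌈n / 2⌉)`. -/
def hMapEquiv : D ≃ ℕ where
  toFun := hMap
  invFun n := ⟨(n / 2, (n + 1) / 2), by dsimp only; omega⟩
  left_inv d := by
    have h := d.2
    rw [hMap_eq_add]
    refine Subtype.ext (Prod.ext ?_ ?_) <;> dsimp only <;> omega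
  right_inv n := by
    refine (hMap_eq_add _).trans ?_
    dsimp only
    omega

/-- The map `h` (with `h(x,x) = 2x`, `h(x,x+1) = 2x+1`) is an isomorphism of
`L₁`-structures from `𝔇` onto `𝔑_E`. -/
theorem hMap_isomorphism : ∃ e : D ≃[L1] ℕ, ∀ d : D, e d = hMap d := by
  refine ⟨{ hMapEquiv with map_fun' := ?_, map_rel' := ?_ }, fun _ => rfl⟩
  · intro n f x
    match n, f with
    | 0, _ => rfl
    | 1, _ => exact hMap_succD (x 0)
  · intro n r x
    match n, r with
    | 1, _ => exact even_hMap_iff (x 0)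
    | 2, _ => exact hMap_lt_iff (x 0) (x 1)
end

section
/- Let ν be an injective map from the set of L₀-sentences to ℕ, and define ν*(A) := 2ν(A) if 𝔑 ⊨ A and ν*(A) := 2ν(A)+1 otherwise. Then ν* is injective, and for every L₀-sentence A: 𝔑 ⊨ A if and only if ν*(A) is even; consequently, the expansion 𝔑_E of 𝔑 satisfies each Tarski biconditional A ↔ E(S^{ν*(A)}(0)), i.e., 𝔑_E ⊨ A iff 𝔑_E ⊨ E(t_A) where t_A is the closed term obtained by applying S to 0 exactly ν*(A) times. -/
open FirstOrder FirstOrder.Language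

/-- The inclusion of languages `L₀ →ᴸ L₁`. -/
def incl : L0 →ᴸ L1 where
  onFunction := fun n f =>
    match n, f with
    | 0, f => f
    | 1, f => f
  onRelation := fun n r =>
    match n, r with
    | 2, r => r

/-- The closed `L₁`-term `S^n(0)`. -/
def numTerm : ℕ → L1.Term (Empty ⊕ Fin 0)
  | 0 => Constants.term (show L1.Constants from Unit.unit)
  | n + 1 => Functions.apply₁ (show L1.Functions 1 from Unit.unit) (numTerm n)

/-- The `L₁`-sentence `E(S^n(0))`. -/
def evenSent (n : ℕ) : L1.Sentence :=
  Relations.boundedFormula₁ (show L1.Relations 1 from Unit.unit) (numTerm n)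

open Classical in
/-- The Gödel numbering `ν*`: `ν*(A) = 2ν(A)` if `𝔑 ⊨ A`, and `ν*(A) = 2ν(A) + 1` otherwise. -/
noncomputable def nuStar (ν : L0.Sentence → ℕ) (A : L0.Sentence) : ℕ :=
  if ℕ ⊨ A then 2 * ν A else 2 * ν A + 1

instance incl_isExpansionOn : incl.IsExpansionOn ℕ where
  map_onFunction {n} f _ :=
    match n, f with
    | 0, _ => rfl
    | 1, _ => rfl
  map_onRelation {n} r _ :=
    match n, r with
    | 2, _ => rfl

theorem realize_numTerm (v : Empty ⊕ Fin 0 → ℕ) (n : ℕ) : (numTerm n).realize v = n := by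
  induction n with
  | zero => rfl
  | succ n ih =>
    change (numTerm n).realize v + 1 = n + 1
    rw [ih]

theorem models_evenSent_iff (n : ℕ) : (ℕ ⊨ evenSent n) ↔ Even n := by
  change Even ((numTerm n).realize _) ↔ Even n
  rw [realize_numTerm]

theorem models_iff_even_nuStar (ν : L0.Sentence → ℕ) (A : L0.Sentence) :
    (ℕ ⊨ A) ↔ Even (nuStar ν A) := by
  unfold nuStar
  split_ifs with h <;> simp [h]

theorem nuStar_div_two (ν : L0.Sentence → ℕ) (A : L0.Sentence) : nuStar ν A / 2 = ν A := by
  unfold nuStar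
  split_ifs <;> omega

/-- If `ν` is an injective numbering of `L₀`-sentences, then `ν*` is injective, a sentence is
true in `𝔑` iff its `ν*`-code is even, and `𝔑_E` satisfies each Tarski biconditional
`A ↔ E(S^{ν*(A)}(0))`. -/
theorem nuStar_tarski_biconditionals (ν : L0.Sentence → ℕ) (hν : Function.Injective ν) :
    Function.Injective (nuStar ν) ∧
    ∀ A : L0.Sentence,
      ((ℕ ⊨ A) ↔ Even (nuStar ν A)) ∧
      ((ℕ ⊨ incl.onSentence A) ↔ (ℕ ⊨ evenSent (nuStar ν A))) := by
  refine ⟨fun A B h => hν ?_, fun A => ⟨models_iff_even_nuStar ν A, ?_⟩⟩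
  · rw [← nuStar_div_two ν A, h, nuStar_div_two]
  · rw [LHom.realize_onSentence, models_evenSent_iff, models_iff_even_nuStar ν A]
end
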